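/- arXiv:1702.02142 — 4 statements merged into one kernel-verified Lean document; each statement's English description precedes it below -/
import Mathlib

section
/- For every integer k ≥ 2, the graph ←Ω_{2^k} satisfies χ_r(←Ω_{2^k}) = χ_r(→C_{2^k}) = k + 1; in particular, every edge of ←Ω_{2^k} that is not an edge of →C_{2^k} is admissible for →C_{2^k}. -/
/-- A directed graph on a subset of ℕ. -/
structure DGraph where
  verts : Set ℕ
  edges : Set (ℕ × ℕ)

/-- `l` is a directed walk in `G` from `u` to `v`. -/
def IsWalkFrom (G : DGraph) (u v : ℕ) (l : List ℕ) : Prop :=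
  l.head? = some u ∧ l.getLast? = some v ∧
    l.Chain' (fun a b => (a, b) ∈ G.edges) ∧ ∀ x ∈ l, x ∈ G.verts

/-- A `k`-ranking of `G`: labels in `{1,…,k}` and every directed path joining two
vertices with the same label contains a vertex with a larger label. -/
def IsRanking (G : DGraph) (k : ℕ) (f : ℕ → ℕ) : Prop :=
  (∀ v ∈ G.verts, 1 ≤ f v ∧ f v ≤ k) ∧
    ∀ u ∈ G.verts, ∀ v ∈ G.verts, u ≠ v → f u = f v →
      ∀ l : List ℕ, IsWalkFrom G u v l → ∃ x ∈ l, f u < f x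

/-- The rank number `χ_r(G)`. -/
noncomputable def rankNumber (G : DGraph) : ℕ := sInf {k | ∃ f : ℕ → ℕ, IsRanking G k f}

def pathEdges (η : ℕ) : Set (ℕ × ℕ) := {p | ∃ i, 1 ≤ i ∧ i + 1 ≤ η ∧ p = (i, i + 1)}

/-- The directed path `→P_η` on vertices `1,…,η`. -/
def pathP (η : ℕ) : DGraph := ⟨Set.Icc 1 η, pathEdges η⟩

/-- The directed cycle `→C_η` on vertices `1,…,η`. -/
def cycleC (η : ℕ) : DGraph := ⟨Set.Icc 1 η, pathEdges η ∪ {(η, 1)}⟩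

/-- Add a single directed edge to a digraph. -/
def addEdge (G : DGraph) (e : ℕ × ℕ) : DGraph := ⟨G.verts, insert e G.edges⟩

/-- The standard label of vertex `i`: `α + 1` where `2^α` is the largest power
of 2 dividing `i`. -/
def stdLabel (i : ℕ) : ℕ := padicValNat 2 i + 1

/-- Edge set of the direct sum graph of type I, `→G_n`. -/
def edgesI : ℕ → Set (ℕ × ℕ)
  | 0 => ∅
  | 1 => ∅
  | 2 => {(1, 2), (2, 3)}
  | n + 3 =>
      edgesI (n + 2) ∪
      (fun p : ℕ × ℕ => (p.1 + 2 ^ (n + 2), p.2 + 2 ^ (n + 2))) '' edgesI (n + 2) ∪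
      {(2 ^ (n + 2) - 1, 2 ^ (n + 2)), (2 ^ (n + 2), 2 ^ (n + 2) + 1)} ∪
      {p | ∃ j, 1 ≤ j ∧ j ≤ 2 ^ (n + 2) - 2 ∧ p = (j, 2 ^ (n + 2))} ∪
      {p | ∃ j, 2 ≤ j ∧ j ≤ 2 ^ (n + 2) - 1 ∧ p = (2 ^ (n + 2), 2 ^ (n + 2) + j)} ∪
      (fun p : ℕ × ℕ => (p.1, p.2 + 2 ^ (n + 2))) '' edgesI (n + 2)

/-- Edge set of the direct sum graph of type II, `←G_n`. -/
def edgesII : ℕ → Set (ℕ × ℕ)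
  | 0 => ∅
  | 1 => ∅
  | 2 => {(1, 2), (2, 3), (2, 1), (3, 2)}
  | n + 3 =>
      edgesII (n + 2) ∪
      (fun p : ℕ × ℕ => (p.1 + 2 ^ (n + 2), p.2 + 2 ^ (n + 2))) '' edgesII (n + 2) ∪
      {(2 ^ (n + 2) - 1, 2 ^ (n + 2)), (2 ^ (n + 2), 2 ^ (n + 2) + 1)} ∪
      {p | ∃ j, 1 ≤ j ∧ j ≤ 2 ^ (n + 2) - 1 ∧ p = (2 ^ (n + 2), j)} ∪
      {p | ∃ j, 1 ≤ j ∧ j ≤ 2 ^ (n + 2) - 1 ∧ p = (2 ^ (n + 2) + j, 2 ^ (n + 2))}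

/-- The direct sum graph of type I, `→G_n`. -/
def GI (n : ℕ) : DGraph := ⟨Set.Icc 1 (2 ^ n - 1), edgesI n⟩

/-- The direct sum graph of type II, `←G_n`. -/
def GII (n : ℕ) : DGraph := ⟨Set.Icc 1 (2 ^ n - 1), edgesII n⟩

/-- The graph `→Ω_{2^k}`. -/
def OmegaI (k : ℕ) : DGraph :=
  ⟨Set.Icc 1 (2 ^ k),
    (cycleC (2 ^ k)).edges ∪ (edgesI k \ pathEdges (2 ^ k - 1)) ∪
      {p | ∃ i, 2 ≤ i ∧ i ≤ 2 ^ k - 2 ∧ p = (2 ^ k, i)}⟩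

/-- The graph `←Ω_{2^k}`. -/
def OmegaII (k : ℕ) : DGraph :=
  ⟨Set.Icc 1 (2 ^ k),
    (cycleC (2 ^ k)).edges ∪ (edgesII k \ pathEdges (2 ^ k - 1)) ∪
      {p | ∃ i, 2 ≤ i ∧ i ≤ 2 ^ k - 2 ∧ p = (i, 2 ^ k)}⟩

/-- Stirling numbers of the second kind. -/
def stirling : ℕ → ℕ → ℕ
  | 0, 0 => 1
  | 0, _ + 1 => 0
  | _ + 1, 0 => 0
  | n + 1, k + 1 => (k + 1) * stirling n (k + 1) + stirling n k

/-- Attach the directed path `→P_j^{v_i}` (directed toward `vi`) to `G`,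
using `w 1, …, w (j-1)` as the new vertices and `vi` in place of `w j`. -/
def attachFwd (G : DGraph) (vi j : ℕ) (w : ℕ → ℕ) : DGraph :=
  ⟨G.verts ∪ w '' Set.Icc 1 (j - 1),
    G.edges ∪ {p | ∃ l, 1 ≤ l ∧ l + 1 ≤ j ∧
      p = (w l, if l + 1 = j then vi else w (l + 1))}⟩

/-- Attach the directed path `←P_j^{v_i}` (directed away from `vi`) to `G`. -/
def attachBwd (G : DGraph) (vi j : ℕ) (w : ℕ → ℕ) : DGraph :=
  ⟨G.verts ∪ w '' Set.Icc 1 (j - 1),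
    G.edges ∪ {p | ∃ l, 1 ≤ l ∧ l + 1 ≤ j ∧
      p = ((if l + 1 = j then vi else w (l + 1)), w l)}⟩

theorem lower_aux (k : ℕ) : ∀ (f : ℕ → ℕ) (a n : ℕ),
    (∀ x, a ≤ x → x < a + n → 1 ≤ f x ∧ f x ≤ k) →
    (∀ x y, a ≤ x → x < y → y < a + n → f x = f y → ∃ z, x ≤ z ∧ z ≤ y ∧ f x < f z) →
    n < 2 ^ k := by
  induction k with
  | zero =>
    intro f a n h _
    by_contra hn
    have := h a le_rfl (by simp at hn; omega)
    omega
  | succ k ih =>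
    intro f a n h1 h2
    have hp : 2 ^ (k + 1) = 2 * 2 ^ k := by ring
    by_cases hx : ∃ x, a ≤ x ∧ x < a + n ∧ f x = k + 1
    · obtain ⟨x, hax, hxn, hfx⟩ := hx
      have hne : ∀ y, a ≤ y → y < a + n → y ≠ x → f y ≤ k := by
        intro y hay hyn hyx
        by_contra hc
        have hy := h1 y hay hyn
        have hfy : f y = k + 1 := by omega
        rcases lt_or_gt_of_ne hyx with hlt | hlt
        · obtain ⟨z, hz1, hz2, hz3⟩ := h2 y x hay hlt hxn (by omega)
          have := h1 z (by omega) (by omega)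
          omega
        · obtain ⟨z, hz1, hz2, hz3⟩ := h2 x y hax hlt hyn (by omega)
          have := h1 z (by omega) (by omega)
          omega
      have e1 := ih f a (x - a)
        (fun y hy1 hy2 => ⟨(h1 y hy1 (by omega)).1, hne y hy1 (by omega) (by omega)⟩)
        (fun y z hy hyz hz => h2 y z hy hyz (by omega))
      have e2 := ih f (x + 1) (a + n - (x + 1))
        (fun y hy1 hy2 => ⟨(h1 y (by omega) (by omega)).1, hne y (by omega) (by omega) (by omega)⟩)
        (fun y z hy hyz hz => h2 y z (by omega) hyz (by omega))
      omega
    · have e1 := ih f a n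
        (fun y hy1 hy2 => ⟨(h1 y hy1 hy2).1, by
          have := (h1 y hy1 hy2).2
          have : f y ≠ k + 1 := fun hc => hx ⟨y, hy1, hy2, hc⟩
          omega⟩) h2
      omega

def GoodE (p : ℕ × ℕ) : Prop :=
  ∀ m, ¬ 2 ^ m ∣ p.1 → ¬ 2 ^ m ∣ p.2 → p.1 / 2 ^ m = p.2 / 2 ^ m

theorem good_path (i : ℕ) : GoodE (i, i + 1) := by
  intro m _ h2
  exact (Nat.succ_div_of_not_dvd h2).symm

/-- an edge within `[0, 2^n]` that touches `2^n` -/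
theorem good_top (n a b : ℕ) (ha : a ≤ 2 ^ n) (hb : b ≤ 2 ^ n) (h : a = 2 ^ n ∨ b = 2 ^ n) :
    GoodE (a, b) := by
  intro m h1 h2
  simp only at h1 h2 ⊢
  by_cases hm : m ≤ n
  · rcases h with h | h
    · exact absurd (h ▸ pow_dvd_pow 2 hm) h1
    · exact absurd (h ▸ pow_dvd_pow 2 hm) h2
  · have : 2 ^ n < 2 ^ m := Nat.pow_lt_pow_right (by norm_num) (by omega)
    rw [Nat.div_eq_of_lt (by omega), Nat.div_eq_of_lt (by omega)]

theorem good_II (n : ℕ) : ∀ p ∈ edgesII (n + 2), p.1 < 2 ^ (n + 2) ∧ p.2 < 2 ^ (n + 2) ∧ GoodE p := by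
  induction n with
  | zero =>
    intro p hp
    simp only [edgesII, Set.mem_insert_iff, Set.mem_singleton_iff] at hp
    rcases hp with rfl | rfl | rfl | rfl
    · exact ⟨by norm_num, by norm_num, good_path 1⟩
    · exact ⟨by norm_num, by norm_num, good_path 2⟩
    · exact ⟨by norm_num, by norm_num, good_top 1 2 1 (by norm_num) (by norm_num) (by simp)⟩
    · refine ⟨by norm_num, by norm_num, fun m h1 h2 => ?_⟩
      rcases m with _ | _ | m
      · simp at h1
      · simp at h2
      · have : 4 ≤ 2 ^ (m + 1 + 1) := by
          have : 1 ≤ 2 ^ m := Nat.one_le_two_pow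
          rw [pow_succ, pow_succ]; omega
        simp only
        rw [Nat.div_eq_of_lt (by omega), Nat.div_eq_of_lt (by omega)]
  | succ n ih =>
    intro p hp
    have hpos : 1 < 2 ^ (n + 2) := Nat.one_lt_two_pow (by omega)
    have hpow : 2 ^ (n + 1 + 2) = 2 * 2 ^ (n + 2) := by ring
    have hge : ∀ m, n + 2 < m → 2 * 2 ^ (n + 2) ≤ 2 ^ m := by
      intro m hm
      rw [← hpow]
      exact Nat.pow_le_pow_right (by norm_num) (by omega)
    rw [show edgesII (n + 1 + 2) = edgesII (n + 3) from rfl, edgesII] at hp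
    simp only [Set.mem_union, Set.mem_image, Set.mem_insert_iff, Set.mem_singleton_iff,
      Set.mem_setOf_eq] at hp
    rcases hp with (((hp | ⟨q, hq, rfl⟩) | (rfl | rfl)) | ⟨j, hj1, hj2, rfl⟩) | ⟨j, hj1, hj2, rfl⟩
    · obtain ⟨h1, h2, h3⟩ := ih p hp
      exact ⟨by omega, by omega, h3⟩
    · obtain ⟨h1, h2, h3⟩ := ih q hq
      refine ⟨by simp only; omega, by simp only; omega, fun m d1 d2 => ?_⟩
      simp only at d1 d2 ⊢
      by_cases hm : m ≤ n + 2
      · have hd : 2 ^ m ∣ 2 ^ (n + 2) := pow_dvd_pow 2 hm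
        rw [Nat.dvd_add_left hd] at d1 d2
        rw [Nat.add_div_of_dvd_left hd, Nat.add_div_of_dvd_left hd, h3 m d1 d2]
      · have := hge m (by omega)
        rw [Nat.div_eq_of_lt (by omega), Nat.div_eq_of_lt (by omega)]
    · refine ⟨by simp only; omega, by simp only; omega, ?_⟩
      exact good_top (n + 2) _ _ (by omega) le_rfl (Or.inr rfl)
    · exact ⟨by simp only; omega, by simp only; omega, good_path _⟩
    · refine ⟨by simp only; omega, by simp only; omega, ?_⟩
      exact good_top (n + 2) _ _ le_rfl (by omega) (Or.inl rfl)
    · refine ⟨by simp only; omega, by simp only; omega, fun m d1 d2 => ?_⟩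
      simp only at d1 d2 ⊢
      by_cases hm : m ≤ n + 2
      · exact absurd (pow_dvd_pow 2 hm) d2
      · have := hge m (by omega)
        rw [Nat.div_eq_of_lt (by omega), Nat.div_eq_of_lt (by omega)]

theorem good_omega (k : ℕ) (hk : 2 ≤ k) : ∀ p ∈ (OmegaII k).edges, GoodE p := by
  intro p hp
  have hpos : 1 ≤ 2 ^ k := Nat.one_le_two_pow
  simp only [OmegaII, cycleC, pathEdges, Set.mem_union, Set.mem_diff, Set.mem_singleton_iff,
    Set.mem_setOf_eq] at hp
  rcases hp with ((⟨i, _, _, rfl⟩ | rfl) | ⟨hp, _⟩) | ⟨i, h1, h2, rfl⟩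
  · exact good_path i
  · exact good_top k _ _ le_rfl hpos (Or.inl rfl)
  · obtain ⟨n, rfl⟩ : ∃ n, k = n + 2 := ⟨k - 2, by omega⟩
    exact (good_II n p hp).2.2
  · exact good_top k _ _ (by omega) le_rfl (Or.inr rfl)

theorem chain_const (R : ℕ → ℕ → Prop) (g : ℕ → ℕ) (P : ℕ → Prop)
    (hR : ∀ a b, P a → P b → R a b → g a = g b) :
    ∀ (l : List ℕ) (u v : ℕ), l.head? = some u → l.getLast? = some v → l.IsChain R →
      (∀ x ∈ l, P x) → g u = g v := by
  intro l
  induction l with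
  | nil => intro u v h; simp at h
  | cons a l ih =>
    intro u v hu hv hc hP
    simp only [List.head?_cons, Option.some.injEq] at hu
    subst hu
    cases l with
    | nil => simp at hv; rw [hv]
    | cons b l =>
      rw [List.isChain_cons_cons] at hc
      rw [hR a b (hP a (by simp)) (hP b (by simp)) hc.1]
      exact ih b v rfl (by simpa using hv) hc.2 (fun x hx => hP x (List.mem_cons_of_mem _ hx))

theorem rank_eq (k : ℕ) (G : DGraph) (hv : G.verts = Set.Icc 1 (2 ^ k))
    (hpath : pathEdges (2 ^ k) ⊆ G.edges) (hgood : ∀ p ∈ G.edges, GoodE p) :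
    rankNumber G = k + 1 := by
  have hup : IsRanking G (k + 1) stdLabel := by
    refine ⟨?_, ?_⟩
    · intro v hvv
      rw [hv] at hvv
      refine ⟨by simp [stdLabel], ?_⟩
      have h1 : 2 ^ padicValNat 2 v ≤ 2 ^ k :=
        (Nat.le_of_dvd hvv.1 pow_padicValNat_dvd).trans hvv.2
      have := (Nat.pow_le_pow_iff_right (by norm_num : 1 < 2)).1 h1
      simp only [stdLabel]; omega
    · intro u hu v hvv huv hf l ⟨w1, w2, w3, w4⟩
      by_contra hcon
      push Not at hcon
      have hnd : ∀ x ∈ l, ¬ 2 ^ stdLabel u ∣ x := by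
        intro x hx hd
        have hx1 := w4 x hx
        rw [hv] at hx1
        have hx0 : x ≠ 0 := by have := hx1.1; omega
        have := (padicValNat_dvd_iff_le (p := 2) hx0).1 hd
        have h2 := hcon x hx
        have : stdLabel x = padicValNat 2 x + 1 := rfl
        omega
      have hq := chain_const _ (fun x => x / 2 ^ stdLabel u) (fun x => ¬ 2 ^ stdLabel u ∣ x)
        (fun a b ha hb hab => hgood (a, b) hab _ ha hb) l u v w1 w2 w3 hnd
      have hum : u ∈ l := List.mem_of_mem_head? (by rw [w1]; rfl)
      have hvm : v ∈ l := List.mem_of_getLast? w2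
      have key : ∀ x, padicValNat 2 x + 1 = stdLabel u → ¬ 2 ^ stdLabel u ∣ x →
          x = 2 ^ padicValNat 2 u * (2 * (x / 2 ^ stdLabel u) + 1) := by
        intro x hx hd
        have he : padicValNat 2 x = padicValNat 2 u := by simp only [stdLabel] at hx; omega
        obtain ⟨c, hc⟩ : 2 ^ padicValNat 2 u ∣ x := he ▸ pow_padicValNat_dvd
        have hs : 2 ^ stdLabel u = 2 ^ padicValNat 2 u * 2 := by rw [stdLabel, pow_succ]
        rw [hs] at hd ⊢
        have hodd : c % 2 = 1 := by
          by_contra h0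
          obtain ⟨d, rfl⟩ : 2 ∣ c := by omega
          exact hd ⟨d, by rw [hc]; ring⟩
        have hdiv : x / (2 ^ padicValNat 2 u * 2) = c / 2 := by
          rw [hc, Nat.mul_div_mul_left _ _ (by positivity)]
        rw [hdiv, show 2 * (c / 2) + 1 = c by omega]
        exact hc
      have e1 := key u rfl (hnd u hum)
      have e2 := key v hf.symm (hnd v hvm)
      rw [hq] at e1
      exact huv (e1.trans e2.symm)
  refine le_antisymm (Nat.sInf_le ⟨_, hup⟩) ?_
  refine le_csInf ⟨_, _, hup⟩ ?_
  rintro j ⟨f, hf1, hf2⟩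
  have hlt : 2 ^ k < 2 ^ j := by
    refine lower_aux j f 1 (2 ^ k) ?_ ?_
    · intro x h1 h2
      exact hf1 x (by rw [hv]; exact ⟨h1, by omega⟩)
    · intro x y hx hxy hy hfe
      have hw : IsWalkFrom G x y (List.range' x (y - x + 1)) := by
        refine ⟨by simp [List.head?_range'], ?_, ?_, ?_⟩
        · rw [List.getLast?_range']; simp; omega
        · change List.IsChain _ _
          rw [List.isChain_iff_getElem]
          intro i hi
          simp only [List.length_range'] at hi
          simp only [List.getElem_range']
          exact hpath ⟨x + 1 * i, by omega, by omega, by simp; omega⟩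
        · intro z hz
          rw [List.mem_range'_1] at hz
          rw [hv]; exact ⟨by omega, by omega⟩
      obtain ⟨z, hz, hz2⟩ := hf2 x (by rw [hv]; exact ⟨hx, by omega⟩) y
        (by rw [hv]; exact ⟨by omega, by omega⟩) (by omega) hfe _ hw
      rw [List.mem_range'_1] at hz
      exact ⟨z, by omega, by omega, hz2⟩
  have := (Nat.pow_lt_pow_iff_right (by norm_num : 1 < 2)).1 hlt
  omega

/-- For `k ≥ 2`, `χ_r(←Ω_{2^k}) = χ_r(→C_{2^k}) = k + 1`; in
particular every edge of `←Ω_{2^k}` not in `→C_{2^k}` is admissible for `→C_{2^k}`. -/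
theorem stmt_11 (k : ℕ) (hk : 2 ≤ k) :
    rankNumber (OmegaII k) = k + 1 ∧ rankNumber (cycleC (2 ^ k)) = k + 1 ∧
    ∀ e ∈ (OmegaII k).edges \ (cycleC (2 ^ k)).edges,
      rankNumber (addEdge (cycleC (2 ^ k)) e) = rankNumber (cycleC (2 ^ k)) := by
  have hsub : (cycleC (2 ^ k)).edges ⊆ (OmegaII k).edges :=
    fun p hp => Or.inl (Or.inl hp)
  have hpc : pathEdges (2 ^ k) ⊆ (cycleC (2 ^ k)).edges := fun p hp => Or.inl hp
  have hg := good_omega k hk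
  have hc := rank_eq k (cycleC (2 ^ k)) rfl hpc (fun p hp => hg p (hsub hp))
  refine ⟨rank_eq k _ rfl (hpc.trans hsub) hg, hc, ?_⟩
  intro e he
  rw [hc]
  refine rank_eq k _ rfl (hpc.trans (Set.subset_insert _ _)) ?_
  intro p hp
  rcases hp with rfl | hp
  · exact hg _ he.1
  · exact hg p (hsub hp)
end

section
/- For every integer k ≥ 2, the total number of edges of the graph →Ω_{2^k} equals 3^k − 2^k. -/
theorem step_card (S : Set (ℕ × ℕ)) (N c : ℕ) (hN : 4 ≤ N) (hf : S.Finite) (hc : S.ncard = c)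
    (hb : ∀ p ∈ S, 1 ≤ p.1 ∧ p.1 < p.2 ∧ p.2 < N) (T : Set (ℕ × ℕ))
    (hT : T = S ∪ (fun p : ℕ × ℕ => (p.1 + N, p.2 + N)) '' S ∪
      {(N - 1, N), (N, N + 1)} ∪
      {p | ∃ j, 1 ≤ j ∧ j ≤ N - 2 ∧ p = (j, N)} ∪
      {p | ∃ j, 2 ≤ j ∧ j ≤ N - 1 ∧ p = (N, N + j)} ∪
      (fun p : ℕ × ℕ => (p.1, p.2 + N)) '' S) :
    T.Finite ∧ T.ncard = 3 * c + 2 * (N - 1) := by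
  have hT2 : T = (((S ∪ (fun p : ℕ × ℕ => (p.1 + N, p.2 + N)) '' S) ∪
      (fun p : ℕ × ℕ => (p.1, p.2 + N)) '' S) ∪ (fun j : ℕ => (j, N)) '' Set.Icc 1 (N - 1)) ∪
      (fun j : ℕ => (N, N + j)) '' Set.Icc 1 (N - 1) := by
    rw [hT]
    ext ⟨a, b⟩
    simp only [Set.mem_union, Set.mem_image, Set.mem_insert_iff, Set.mem_singleton_iff,
      Set.mem_setOf_eq, Prod.mk.injEq, Set.mem_Icc]
    constructor
    · rintro (((((h | h) | (h | h)) | ⟨j, h⟩) | ⟨j, h⟩) | h)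
      · exact Or.inl (Or.inl (Or.inl (Or.inl h)))
      · exact Or.inl (Or.inl (Or.inl (Or.inr h)))
      · exact Or.inl (Or.inr ⟨a, by omega⟩)
      · exact Or.inr ⟨1, by omega⟩
      · exact Or.inl (Or.inr ⟨j, by omega⟩)
      · exact Or.inr ⟨j, by omega⟩
      · exact Or.inl (Or.inl (Or.inr h))
    · rintro ((((h | h) | h) | ⟨j, h⟩) | ⟨j, h⟩)
      · exact Or.inl (Or.inl (Or.inl (Or.inl (Or.inl h))))
      · exact Or.inl (Or.inl (Or.inl (Or.inl (Or.inr h))))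
      · exact Or.inr h
      · by_cases hj : j = N - 1
        · exact Or.inl (Or.inl (Or.inl (Or.inr (Or.inl (by omega)))))
        · exact Or.inl (Or.inl (Or.inr ⟨j, by omega⟩))
      · by_cases hj : j = 1
        · exact Or.inl (Or.inl (Or.inl (Or.inr (Or.inr (by omega)))))
        · exact Or.inl (Or.inr ⟨j, by omega⟩)
  have f1 := hf.image (fun p : ℕ × ℕ => (p.1 + N, p.2 + N))
  have f2 := hf.image (fun p : ℕ × ℕ => (p.1, p.2 + N))
  have f3 := (Set.finite_Icc 1 (N - 1)).image (fun j : ℕ => (j, N))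
  have f4 := (Set.finite_Icc 1 (N - 1)).image (fun j : ℕ => (N, N + j))
  have hI : (Set.Icc 1 (N - 1)).ncard = N - 1 := by
    rw [Set.ncard_eq_toFinset_card']; simp
  have n1 : ((fun p : ℕ × ℕ => (p.1 + N, p.2 + N)) '' S).ncard = c := by
    rw [Set.ncard_image_of_injective, hc]
    rintro ⟨a, b⟩ ⟨a', b'⟩ h
    simp only [Prod.mk.injEq] at h ⊢
    omega
  have n2 : ((fun p : ℕ × ℕ => (p.1, p.2 + N)) '' S).ncard = c := by
    rw [Set.ncard_image_of_injective, hc]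
    rintro ⟨a, b⟩ ⟨a', b'⟩ h
    simp only [Prod.mk.injEq] at h ⊢
    omega
  have n3 : ((fun j : ℕ => (j, N)) '' Set.Icc 1 (N - 1)).ncard = N - 1 := by
    rw [Set.ncard_image_of_injective, hI]
    intro a b h
    simp only [Prod.mk.injEq] at h
    omega
  have n4 : ((fun j : ℕ => (N, N + j)) '' Set.Icc 1 (N - 1)).ncard = N - 1 := by
    rw [Set.ncard_image_of_injective, hI]
    intro a b h
    simp only [Prod.mk.injEq] at h
    omega
  subst hT2
  refine ⟨(((hf.union f1).union f2).union f3).union f4, ?_⟩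
  rw [Set.ncard_union_eq _ (((hf.union f1).union f2).union f3) f4,
    Set.ncard_union_eq _ ((hf.union f1).union f2) f3,
    Set.ncard_union_eq _ (hf.union f1) f2, Set.ncard_union_eq _ hf f1, hc, n1, n2, n3, n4]
  · omega
  · rw [Set.disjoint_left]
    rintro p h ⟨q, hq, rfl⟩
    have := hb _ h
    have := hb _ hq
    simp only at *
    omega
  · rw [Set.disjoint_left]
    rintro p (h | ⟨r, hr, rfl⟩) ⟨q, hq, h'⟩
    · subst h'
      have := hb _ h
      simp only at *
      omega
    · have := hb _ hr
      have := hb _ hq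
      simp only [Prod.mk.injEq] at *
      omega
  · rw [Set.disjoint_left]
    rintro p ((h | ⟨r, hr, rfl⟩) | ⟨r, hr, rfl⟩) ⟨q, hq, h'⟩
    · subst h'
      have := hb _ h
      simp only at *
      omega
    · have := hb _ hr
      simp only [Prod.mk.injEq] at *
      omega
    · have := hb _ hr
      simp only [Prod.mk.injEq] at *
      omega
  · rw [Set.disjoint_left]
    rintro p (((h | ⟨r, hr, rfl⟩) | ⟨r, hr, rfl⟩) | ⟨r, hr, rfl⟩) ⟨q, hq, h'⟩
    · subst h'
      have := hb _ h
      simp only at *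
      omega
    · have := hb _ hr
      simp only [Prod.mk.injEq] at *
      omega
    · have := hb _ hr
      simp only [Prod.mk.injEq] at *
      omega
    · simp only [Prod.mk.injEq, Set.mem_Icc] at *
      omega

theorem edgesI_facts (n : ℕ) : (edgesI (n + 2)).Finite ∧
    (edgesI (n + 2)).ncard + 2 ^ (n + 3) = 3 ^ (n + 2) + 1 ∧
    (∀ p ∈ edgesI (n + 2), 1 ≤ p.1 ∧ p.1 < p.2 ∧ p.2 < 2 ^ (n + 2)) ∧
    (∀ i, 1 ≤ i → i + 1 < 2 ^ (n + 2) → (i, i + 1) ∈ edgesI (n + 2)) := by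
  induction n with
  | zero =>
    simp only [zero_add, edgesI]
    refine ⟨by simp, ?_, ?_, ?_⟩
    · rw [Set.ncard_pair (by simp)]; norm_num
    · rintro p (rfl | rfl) <;> simp
    · intro i h1 h2
      have : i = 1 ∨ i = 2 := by omega
      rcases this with rfl | rfl <;> simp
  | succ n ih =>
    obtain ⟨hf, hc, hb, hp⟩ := ih
    have hN : 4 ≤ 2 ^ (n + 2) := by
      have : 1 ≤ 2 ^ n := Nat.one_le_two_pow
      rw [pow_add]; omega
    have e1 : 2 ^ (n + 1 + 2) = 2 * 2 ^ (n + 2) := by ring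
    have e2 : 2 ^ (n + 1 + 3) = 4 * 2 ^ (n + 2) := by ring
    have e3 : 2 ^ (n + 3) = 2 * 2 ^ (n + 2) := by ring
    have e4 : 3 ^ (n + 1 + 2) = 3 * 3 ^ (n + 2) := by ring
    have hs := step_card (edgesI (n + 2)) (2 ^ (n + 2)) _ hN hf rfl hb (edgesI (n + 1 + 2)) rfl
    refine ⟨hs.1, ?_, ?_, ?_⟩
    · rw [hs.2, e2, e4]; rw [e3] at hc; omega
    · rw [e1]
      change ∀ p ∈ edgesI (n + 3), _
      simp only [edgesI]
      rintro p (((((h | ⟨r, hr, rfl⟩) | (rfl | rfl)) | ⟨j, h1, h2, rfl⟩) | ⟨j, h1, h2, rfl⟩) | ⟨r, hr, rfl⟩)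
      · have := hb _ h; omega
      · have := hb _ hr; simp only; omega
      · simp only; omega
      · simp only; omega
      · simp only; omega
      · simp only; omega
      · have := hb _ hr; simp only; omega
    · rw [e1]
      intro i h1 h2
      change _ ∈ edgesI (n + 3)
      simp only [edgesI]
      rcases lt_or_ge (i + 1) (2 ^ (n + 2)) with h | h
      · exact Or.inl (Or.inl (Or.inl (Or.inl (Or.inl (hp i h1 h)))))
      · rcases lt_or_ge (2 ^ (n + 2)) i with h' | h'
        · refine Or.inl (Or.inl (Or.inl (Or.inl (Or.inr ⟨_, hp (i - 2 ^ (n + 2)) (by omega) (by omega), ?_⟩))))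
          simp only [Prod.mk.injEq]; omega
        · refine Or.inl (Or.inl (Or.inl (Or.inr ?_)))
          simp only [Set.mem_insert_iff, Set.mem_singleton_iff, Prod.mk.injEq]
          omega

/-- For `k ≥ 2`, the number of edges of `→Ω_{2^k}` equals `3^k − 2^k`. -/
theorem stmt_12 (k : ℕ) (hk : 2 ≤ k) :
    (OmegaI k).edges.ncard = 3 ^ k - 2 ^ k := by
  obtain ⟨n, rfl⟩ : ∃ n, k = n + 2 := ⟨k - 2, by omega⟩
  obtain ⟨hf, hc, hb, hp⟩ := edgesI_facts n
  have hN : 4 ≤ 2 ^ (n + 2) := by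
    have : 1 ≤ 2 ^ n := Nat.one_le_two_pow
    rw [pow_add]; omega
  have e3 : 2 ^ (n + 3) = 2 * 2 ^ (n + 2) := by ring
  rw [e3] at hc
  have key : (OmegaI (n + 2)).edges = (edgesI (n + 2) ∪ {(2 ^ (n + 2) - 1, 2 ^ (n + 2))}) ∪
      (fun j : ℕ => (2 ^ (n + 2), j)) '' Set.Icc 1 (2 ^ (n + 2) - 2) := by
    simp only [OmegaI, cycleC, pathEdges]
    generalize 2 ^ (n + 2) = N at *
    ext ⟨a, b⟩
    simp only [Set.mem_union, Set.mem_image, Set.mem_singleton_iff, Set.mem_diff,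
      Set.mem_setOf_eq, Prod.mk.injEq, Set.mem_Icc]
    constructor
    · rintro (((⟨i, h1, h2, rfl, rfl⟩ | h) | h) | ⟨i, h⟩)
      · by_cases h : a + 1 = N
        · exact Or.inl (Or.inr (by omega))
        · exact Or.inl (Or.inl (hp a h1 (by omega)))
      · exact Or.inr ⟨1, by omega⟩
      · exact Or.inl (Or.inl h.1)
      · exact Or.inr ⟨i, by omega⟩
    · rintro ((h | h) | ⟨i, h⟩)
      · by_cases h' : b = a + 1
        · have := hb _ h
          exact Or.inl (Or.inl (Or.inl ⟨a, by simp only at this; omega⟩))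
        · refine Or.inl (Or.inr ⟨h, ?_⟩)
          rintro ⟨i, h⟩
          omega
      · exact Or.inl (Or.inl (Or.inl ⟨a, by omega⟩))
      · by_cases h' : i = 1
        · exact Or.inl (Or.inl (Or.inr (by omega)))
        · exact Or.inr ⟨i, by omega⟩
  rw [key]
  generalize 2 ^ (n + 2) = N at *
  have hI : ((fun j : ℕ => (N, j)) '' Set.Icc 1 (N - 2)).ncard = N - 2 := by
    rw [Set.ncard_image_of_injective, Set.ncard_eq_toFinset_card']
    · simp
    · intro a b h
      simpa using h
  rw [Set.ncard_union_eq _ (hf.union (Set.finite_singleton _)) ((Set.finite_Icc _ _).image _),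
    Set.ncard_union_eq _ hf (Set.finite_singleton _), Set.ncard_singleton, hI]
  · omega
  · rw [Set.disjoint_left]
    rintro p h rfl
    have := hb _ h
    simp only at this
    omega
  · rw [Set.disjoint_left]
    rintro p (h | rfl) ⟨q, hq, h'⟩
    · subst h'
      have := hb _ h
      simp only at this
      omega
    · simp only [Prod.mk.injEq] at h'
      omega
end

section
/- Let k ≥ 2 and let G' be either the direct sum graph of type I →G_k or of type II ←G_k, on vertices v_1,…,v_{2^k−1}. For a positive integer m let h(m) = α + 1 where 2^α is the largest power of 2 dividing m (so h(m) is the label of v_m in the unique minimal ranking of →P_{2^k−1}). Let (N_t)_{t∈I} be a family of finite directed graphs such that each N_t shares with G' exactly one vertex v_{i_t}, where 2 ≤ i_t ≤ 2^k−2 (its vertex of attachment), and the vertex sets of distinct N_t intersect only inside V(G'). If for every t ∈ I one has χ_r(N_t) = h(i_t) and N_t admits a minimal ranking f_t with f_t(v_{i_t}) = h(i_t), then χ_r(G' ∪ ⋃_{t∈I} N_t) = χ_r(→P_{2^k−1}) = k. -/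
theorem aux_walk_rtg (G : DGraph) (f : ℕ → ℕ) (j : ℕ) : ∀ (l : List ℕ) (u v : ℕ),
    IsWalkFrom G u v l → (∀ x ∈ l, f x ≤ j) →
    Relation.ReflTransGen (fun a b => (a, b) ∈ G.edges ∧ f a ≤ j ∧ f b ≤ j) u v := by
  intro l
  induction l with
  | nil => intro u v h; simp [IsWalkFrom] at h
  | cons a l ih =>
    intro u v h hj
    obtain ⟨h1, h2, h3, h4⟩ := h
    simp at h1
    subst h1
    cases l with
    | nil =>
      simp at h2
      subst h2
      exact Relation.ReflTransGen.refl
    | cons b l =>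
      have h3' : (a, b) ∈ G.edges ∧ List.IsChain (fun a b => (a, b) ∈ G.edges) (b :: l) := by
        have h5 : List.IsChain (fun a b => (a, b) ∈ G.edges) (a :: b :: l) := h3
        simpa using h5
      refine Relation.ReflTransGen.head ⟨h3'.1, hj a (by simp), hj b (by simp)⟩
        (ih b v ⟨by simp, by simpa using h2, h3'.2, fun x hx => h4 x (by simp at hx ⊢; tauto)⟩
          (fun x hx => hj x (by simp at hx ⊢; tauto)))

theorem aux_rtg_walk (G : DGraph) (hw : ∀ p ∈ G.edges, p.1 ∈ G.verts ∧ p.2 ∈ G.verts)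
    (f : ℕ → ℕ) (j : ℕ) (u v : ℕ) (hv : v ∈ G.verts) (hvj : f v ≤ j)
    (h : Relation.ReflTransGen (fun a b => (a, b) ∈ G.edges ∧ f a ≤ j ∧ f b ≤ j) u v) :
    ∃ l, IsWalkFrom G u v l ∧ ∀ x ∈ l, f x ≤ j := by
  induction h using Relation.ReflTransGen.head_induction_on with
  | refl => exact ⟨[v], ⟨by simp, by simp, List.isChain_singleton _, by simpa using hv⟩, by simpa using hvj⟩
  | head hab hprev ih =>
    rename_i a b
    obtain ⟨l, ⟨h1, h2, h3, h4⟩, hl⟩ := ih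
    cases l with
    | nil => simp at h1
    | cons c l =>
      simp at h1
      subst h1
      refine ⟨a :: c :: l, ⟨by simp, by simpa using h2, ?_, ?_⟩, ?_⟩
      · have : List.IsChain (fun a b => (a, b) ∈ G.edges) (c :: l) := h3
        show List.IsChain _ _
        simp only [List.isChain_cons_cons]
        exact ⟨hab.1, this⟩
      · intro x hx
        rcases List.mem_cons.1 hx with rfl | hx
        · exact (hw _ hab.1).1
        · exact h4 x hx
      · intro x hx
        rcases List.mem_cons.1 hx with rfl | hx
        · exact hab.2.1
        · exact hl x hx

theorem aux_rank_of_rtg (G : DGraph) (k : ℕ) (f : ℕ → ℕ)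
    (h1 : ∀ v ∈ G.verts, 1 ≤ f v ∧ f v ≤ k)
    (h2 : ∀ u ∈ G.verts, ∀ v ∈ G.verts, f u = f v →
      Relation.ReflTransGen (fun a b => (a, b) ∈ G.edges ∧ f a ≤ f u ∧ f b ≤ f u) u v → u = v) :
    IsRanking G k f := by
  refine ⟨h1, fun u hu v hv huv hf l hl => ?_⟩
  by_contra hc
  push Not at hc
  exact huv (h2 u hu v hv hf (aux_walk_rtg G f (f u) l u v hl hc))

theorem aux_rtg_of_rank (G : DGraph) (hw : ∀ p ∈ G.edges, p.1 ∈ G.verts ∧ p.2 ∈ G.verts)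
    (k : ℕ) (f g : ℕ → ℕ) (hr : IsRanking G k g) (hfg : ∀ x ∈ G.verts, f x = g x) (j : ℕ)
    (u v : ℕ) (hu : u ∈ G.verts) (hv : v ∈ G.verts) (huj : f u = j) (hvj : f v = j)
    (h : Relation.ReflTransGen (fun a b => (a, b) ∈ G.edges ∧ f a ≤ j ∧ f b ≤ j) u v) :
    u = v := by
  by_contra hne
  obtain ⟨l, hl, hl2⟩ := aux_rtg_walk G hw f j u v hv hvj.le h
  obtain ⟨x, hx, hlt⟩ := hr.2 u hu v hv hne (by rw [← hfg u hu, ← hfg v hv, huj, hvj]) l hl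
  have := hl2 x hx
  rw [← hfg u hu, ← hfg x (hl.2.2.2 x hx)] at hlt
  omega

theorem aux_label_le {a j : ℕ} (ha : a ≠ 0) : stdLabel a ≤ j ↔ ¬ 2 ^ j ∣ a := by
  have := padicValNat_dvd_iff_le (p := 2) (a := a) (n := j) ha
  rw [this, stdLabel]
  omega

theorem aux_label_mod {a : ℕ} (ha : a ≠ 0) :
    a % 2 ^ stdLabel a = 2 ^ (stdLabel a - 1) := by
  have h1 : ¬ 2 ^ stdLabel a ∣ a := (aux_label_le ha).1 le_rfl
  have h2 : 2 ^ (stdLabel a - 1) ∣ a := by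
    by_contra h
    have := (aux_label_le ha).2 h
    simp [stdLabel] at this
  obtain ⟨m, hm⟩ : ∃ m, stdLabel a = m + 1 := ⟨_, rfl⟩
  rw [hm] at h1 h2 ⊢
  simp only [Nat.add_sub_cancel] at h2 ⊢
  obtain ⟨q, rfl⟩ := h2
  rw [pow_succ, Nat.mul_mod_mul_left]
  rw [pow_succ] at h1
  have : q % 2 = 1 := by
    by_contra h
    exact h1 (Nat.mul_dvd_mul_left _ (by omega))
  rw [this, mul_one]

theorem aux_I_bound (n : ℕ) : ∀ a b, (a, b) ∈ edgesI (n + 2) →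
    1 ≤ a ∧ a < b ∧ b < 2 ^ (n + 2) := by
  induction n with
  | zero => intro a b h; simp [edgesI] at h; omega
  | succ n ih =>
    intro a b h
    have hp : 2 ^ (n + 1 + 2) = 2 * 2 ^ (n + 2) := by ring
    have hp4 : 4 ≤ 2 ^ (n + 2) := by
      have : 2 ^ (n + 2) = 2 ^ n * 4 := by ring
      have := Nat.one_le_two_pow (n := n)
      omega
    rw [hp]
    simp only [edgesI] at h
    simp only [Set.mem_union, Set.mem_image, Prod.exists, Prod.mk.injEq, Set.mem_insert_iff,
      Set.mem_singleton_iff, Set.mem_ofPred_eq] at h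
    rcases h with ((((h | ⟨x, y, h, h1, h2⟩) | h) | ⟨j, h⟩) | ⟨j, h⟩) | ⟨x, y, h, h1, h2⟩
    · have := ih a b h; omega
    · have := ih x y h; omega
    · omega
    · omega
    · omega
    · have := ih x y h; omega

theorem aux_II_bound (n : ℕ) : ∀ a b, (a, b) ∈ edgesII (n + 2) →
    1 ≤ a ∧ 1 ≤ b ∧ a < 2 ^ (n + 2) ∧ b < 2 ^ (n + 2) := by
  induction n with
  | zero => intro a b h; simp [edgesII] at h; omega
  | succ n ih =>
    intro a b h
    have hp : 2 ^ (n + 1 + 2) = 2 * 2 ^ (n + 2) := by ring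
    have hp4 : 4 ≤ 2 ^ (n + 2) := by
      have : 2 ^ (n + 2) = 2 ^ n * 4 := by ring
      have := Nat.one_le_two_pow (n := n)
      omega
    rw [hp]
    simp only [edgesII] at h
    simp only [Set.mem_union, Set.mem_image, Prod.exists, Prod.mk.injEq, Set.mem_insert_iff,
      Set.mem_singleton_iff, Set.mem_ofPred_eq] at h
    rcases h with (((h | ⟨x, y, h, h1, h2⟩) | h) | ⟨j, h⟩) | ⟨j, h⟩
    · have := ih a b h; omega
    · have := ih x y h; omega
    · omega
    · omega
    · omega

theorem aux_dvd_add {j n x : ℕ} (h : j ≤ n) : 2 ^ j ∣ x + 2 ^ n ↔ 2 ^ j ∣ x :=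
  Nat.dvd_add_left (pow_dvd_pow 2 h)

theorem aux_mod_add {j n x : ℕ} (h : j ≤ n) : (x + 2 ^ n) % 2 ^ j = x % 2 ^ j := by
  obtain ⟨c, hc⟩ := pow_dvd_pow 2 h
  rw [hc, Nat.add_mul_mod_self_left]

theorem aux_I_mod (j n : ℕ) : ∀ a b, (a, b) ∈ edgesI (n + 2) → ¬ 2 ^ j ∣ a → ¬ 2 ^ j ∣ b →
    a % 2 ^ j < b % 2 ^ j := by
  induction n with
  | zero =>
    intro a b h ha hb
    by_cases hj : 2 ≤ j
    · have h1 := aux_I_bound 0 a b h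
      have h2 : 2 ^ (0 + 2) ≤ 2 ^ j := Nat.pow_le_pow_right (by norm_num) hj
      rw [Nat.mod_eq_of_lt (by omega), Nat.mod_eq_of_lt (by omega)]
      omega
    · have : j = 0 ∨ j = 1 := by omega
      simp [edgesI] at h
      rcases this with rfl | rfl
      · simp at ha
      · simp at ha hb
        omega
  | succ n ih =>
    intro a b h ha hb
    by_cases hj : n + 3 ≤ j
    · have h1 := aux_I_bound (n + 1) a b h
      have h2 : 2 ^ (n + 1 + 2) ≤ 2 ^ j := Nat.pow_le_pow_right (by norm_num) hj
      rw [Nat.mod_eq_of_lt (by omega), Nat.mod_eq_of_lt (by omega)]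
      omega
    · have hj' : j ≤ n + 2 := by omega
      have hd : 2 ^ j ∣ 2 ^ (n + 2) := pow_dvd_pow 2 hj'
      simp only [edgesI] at h
      simp only [Set.mem_union, Set.mem_image, Prod.exists, Prod.mk.injEq, Set.mem_insert_iff,
        Set.mem_singleton_iff, Set.mem_ofPred_eq] at h
      rcases h with ((((h | ⟨x, y, h, rfl, rfl⟩) | (⟨-, rfl⟩ | ⟨rfl, -⟩)) |
        ⟨j, -, -, -, rfl⟩) | ⟨j, -, -, rfl, -⟩) | ⟨x, y, h, rfl, rfl⟩
      · exact ih a b h ha hb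
      · rw [aux_dvd_add hj'] at ha hb
        rw [aux_mod_add hj', aux_mod_add hj']
        exact ih x y h ha hb
      · exact absurd hd hb
      · exact absurd hd ha
      · exact absurd hd hb
      · exact absurd hd ha
      · rw [aux_dvd_add hj'] at hb
        rw [aux_mod_add hj']
        exact ih x y h ha hb

theorem aux_II_div (j n : ℕ) : ∀ a b, (a, b) ∈ edgesII (n + 2) → ¬ 2 ^ j ∣ a → ¬ 2 ^ j ∣ b →
    a / 2 ^ j = b / 2 ^ j := by
  induction n with
  | zero =>
    intro a b h ha hb
    by_cases hj : 2 ≤ j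
    · have h1 := aux_II_bound 0 a b h
      have h2 : 2 ^ (0 + 2) ≤ 2 ^ j := Nat.pow_le_pow_right (by norm_num) hj
      rw [Nat.div_eq_of_lt (by omega), Nat.div_eq_of_lt (by omega)]
    · have : j = 0 ∨ j = 1 := by omega
      simp [edgesII] at h
      rcases this with rfl | rfl
      · simp at ha
      · simp at ha hb
        omega
  | succ n ih =>
    intro a b h ha hb
    by_cases hj : n + 3 ≤ j
    · have h1 := aux_II_bound (n + 1) a b h
      have h2 : 2 ^ (n + 1 + 2) ≤ 2 ^ j := Nat.pow_le_pow_right (by norm_num) hj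
      rw [Nat.div_eq_of_lt (by omega), Nat.div_eq_of_lt (by omega)]
    · have hj' : j ≤ n + 2 := by omega
      have hd : 2 ^ j ∣ 2 ^ (n + 2) := pow_dvd_pow 2 hj'
      simp only [edgesII] at h
      simp only [Set.mem_union, Set.mem_image, Prod.exists, Prod.mk.injEq, Set.mem_insert_iff,
        Set.mem_singleton_iff, Set.mem_ofPred_eq] at h
      rcases h with (((h | ⟨x, y, h, rfl, rfl⟩) | (⟨-, rfl⟩ | ⟨rfl, -⟩)) |
        ⟨j, -, -, rfl, -⟩) | ⟨j, -, -, -, rfl⟩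
      · exact ih a b h ha hb
      · rw [aux_dvd_add hj'] at ha hb
        rw [Nat.add_div_of_dvd_left hd, Nat.add_div_of_dvd_left hd, ih x y h ha hb]
      · exact absurd hd hb
      · exact absurd hd ha
      · exact absurd hd ha
      · exact absurd hd hb

theorem aux_path_I (n : ℕ) : ∀ i, 1 ≤ i → i + 1 < 2 ^ (n + 2) → (i, i + 1) ∈ edgesI (n + 2) := by
  induction n with
  | zero => intro i h1 h2; simp [edgesI]; omega
  | succ n ih =>
    intro i h1 h2
    have hp : 2 ^ (n + 1 + 2) = 2 * 2 ^ (n + 2) := by ring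
    rw [hp] at h2
    simp only [edgesI]
    simp only [Set.mem_union, Set.mem_image, Prod.exists, Prod.mk.injEq, Set.mem_insert_iff,
      Set.mem_singleton_iff, Set.mem_ofPred_eq]
    refine Or.inl (Or.inl (Or.inl ?_))
    rcases lt_trichotomy (i + 1) (2 ^ (n + 2)) with h | h | h
    · exact Or.inl (Or.inl (ih i h1 h))
    · right; omega
    · by_cases h' : i = 2 ^ (n + 2)
      · right; omega
      · left; right
        refine ⟨_, _, ih (i - 2 ^ (n + 2)) (by omega) (by omega), by omega, by omega⟩

theorem aux_path_II (n : ℕ) : ∀ i, 1 ≤ i → i + 1 < 2 ^ (n + 2) → (i, i + 1) ∈ edgesII (n + 2) := by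
  induction n with
  | zero => intro i h1 h2; simp [edgesII]; omega
  | succ n ih =>
    intro i h1 h2
    have hp : 2 ^ (n + 1 + 2) = 2 * 2 ^ (n + 2) := by ring
    rw [hp] at h2
    simp only [edgesII]
    simp only [Set.mem_union, Set.mem_image, Prod.exists, Prod.mk.injEq, Set.mem_insert_iff,
      Set.mem_singleton_iff, Set.mem_ofPred_eq]
    refine Or.inl (Or.inl ?_)
    rcases lt_trichotomy (i + 1) (2 ^ (n + 2)) with h | h | h
    · exact Or.inl (Or.inl (ih i h1 h))
    · right; omega
    · by_cases h' : i = 2 ^ (n + 2)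
      · right; omega
      · left; right
        refine ⟨_, _, ih (i - 2 ^ (n + 2)) (by omega) (by omega), by omega, by omega⟩

theorem aux_len (f : ℕ → ℕ) (m : ℕ) : ∀ a L : ℕ,
    (∀ x, a ≤ x → x < a + L → 1 ≤ f x ∧ f x ≤ m) →
    (∀ u v, a ≤ u → u < v → v < a + L → f u = f v → ∃ x, u ≤ x ∧ x ≤ v ∧ f u < f x) →
    L < 2 ^ m := by
  induction m with
  | zero =>
    intro a L h1 _
    by_contra h
    have := h1 a le_rfl (by simp at h; omega)
    omega
  | succ m ih =>
    intro a L h1 h2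
    by_cases hc : ∃ c, a ≤ c ∧ c < a + L ∧ f c = m + 1
    · obtain ⟨c, hc1, hc2, hc3⟩ := hc
      have huniq : ∀ x, a ≤ x → x < a + L → x ≠ c → 1 ≤ f x ∧ f x ≤ m := by
        intro x hx1 hx2 hne
        have := h1 x hx1 hx2
        refine ⟨this.1, ?_⟩
        by_contra hcon
        have hxm : f x = m + 1 := by omega
        rcases lt_or_gt_of_ne hne with h | h
        · obtain ⟨y, hy1, hy2, hy3⟩ := h2 x c hx1 h hc2 (by omega)
          have := h1 y (by omega) (by omega)
          omega
        · obtain ⟨y, hy1, hy2, hy3⟩ := h2 c x hc1 h hx2 (by omega)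
          have := h1 y (by omega) (by omega)
          omega
      have hl := ih a (c - a) (fun x hx1 hx2 => huniq x hx1 (by omega) (by omega))
        (fun u v hu huv hv => h2 u v hu huv (by omega))
      have hr := ih (c + 1) (a + L - (c + 1))
        (fun x hx1 hx2 => huniq x (by omega) (by omega) (by omega))
        (fun u v hu huv hv => h2 u v (by omega) huv (by omega))
      rw [pow_succ]
      omega
    · push Not at hc
      have := ih a L (fun x hx1 hx2 => by
        have := h1 x hx1 hx2
        have := hc x hx1 hx2
        omega) h2
      rw [pow_succ]
      omega

theorem aux_path_walk (η : ℕ) (d : ℕ) : ∀ u, 1 ≤ u → u + d ≤ η →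
    IsWalkFrom (pathP η) u (u + d) (List.range' u (d + 1)) := by
  intro u hu hd
  refine ⟨by simp [List.range'_succ], by simp [List.getLast?_range'], ?_, ?_⟩
  · show List.IsChain _ _
    rw [List.isChain_iff_getElem]
    intro i hi
    simp at hi
    simp [pathP, pathEdges]
    omega
  · intro x hx
    simp [List.mem_range'] at hx
    simp [pathP]
    omega

theorem aux_lower (k m : ℕ) (f : ℕ → ℕ) (h : IsRanking (pathP (2 ^ k - 1)) m f) : k ≤ m := by
  have := aux_len f m 1 (2 ^ k - 1)
    (fun x h1 h2 => h.1 x (by simp [pathP]; omega))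
    (fun u v hu huv hv he => by
      obtain ⟨d, rfl⟩ := Nat.exists_eq_add_of_lt huv
      obtain ⟨x, hx, hlt⟩ := h.2 u (by simp [pathP]; omega) _ (by simp [pathP]; omega)
        (by omega) he _ (aux_path_walk (2 ^ k - 1) (d + 1) u hu (by omega))
      simp [List.mem_range'] at hx
      exact ⟨x, by omega, by omega, hlt⟩)
  have h2 : 2 ^ k ≤ 2 ^ m := by omega
  exact (Nat.pow_le_pow_iff_right (by norm_num)).1 h2

theorem aux_mono (G H : DGraph) (hv : G.verts ⊆ H.verts) (he : G.edges ⊆ H.edges) (k : ℕ)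
    (f : ℕ → ℕ) (h : IsRanking H k f) : IsRanking G k f := by
  refine ⟨fun v hv' => h.1 v (hv hv'), fun u hu v hv' hne hf l hl => ?_⟩
  refine h.2 u (hv hu) v (hv hv') hne hf l ⟨hl.1, hl.2.1, ?_, fun x hx => hv (hl.2.2.2 x hx)⟩
  have : List.IsChain (fun a b => (a, b) ∈ G.edges) l := hl.2.2.1
  exact this.imp (fun a b hab => he hab)

theorem aux_base (k : ℕ) (hk : 2 ≤ k) (G' : DGraph) (hG : G' = GI k ∨ G' = GII k) :
    G'.verts = Set.Icc 1 (2 ^ k - 1) ∧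
    (∀ p ∈ G'.edges, p.1 ∈ G'.verts ∧ p.2 ∈ G'.verts) ∧
    pathEdges (2 ^ k - 1) ⊆ G'.edges ∧
    (∀ j u v, u ∈ G'.verts → v ∈ G'.verts → stdLabel u = j → stdLabel v = j →
      Relation.ReflTransGen (fun a b => (a, b) ∈ G'.edges ∧ stdLabel a ≤ j ∧ stdLabel b ≤ j) u v →
      u = v) := by
  obtain ⟨n, rfl⟩ : ∃ n, k = n + 2 := ⟨k - 2, by omega⟩
  rcases hG with rfl | rfl
  · refine ⟨rfl, ?_, ?_, ?_⟩
    · rintro ⟨a, b⟩ h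
      have := aux_I_bound n a b h
      simp [GI]
      omega
    · rintro p ⟨i, h1, h2, rfl⟩
      exact aux_path_I n i h1 (by omega)
    · intro j u v hu hv huj hvj h
      have key : u = v ∨ u % 2 ^ j < v % 2 ^ j := by
        clear hv hvj
        induction h with
        | refl => exact Or.inl rfl
        | tail hprev hbc ih =>
          rename_i b c
          have hb := aux_I_bound n b c hbc.1
          have := aux_I_mod j n b c hbc.1 ((aux_label_le (by omega)).1 hbc.2.1)
            ((aux_label_le (by omega)).1 hbc.2.2)
          rcases ih with rfl | ih
          · exact Or.inr this
          · exact Or.inr (ih.trans this)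
      simp [GI] at hu hv
      have h1 := aux_label_mod (a := u) (by omega)
      have h2 := aux_label_mod (a := v) (by omega)
      rw [huj] at h1
      rw [hvj] at h2
      omega
  · refine ⟨rfl, ?_, ?_, ?_⟩
    · rintro ⟨a, b⟩ h
      have := aux_II_bound n a b h
      simp [GII]
      omega
    · rintro p ⟨i, h1, h2, rfl⟩
      exact aux_path_II n i h1 (by omega)
    · intro j u v hu hv huj hvj h
      have key : u / 2 ^ j = v / 2 ^ j := by
        clear hv hvj
        induction h with
        | refl => rfl
        | tail hprev hbc ih =>
          rename_i b c
          have hb := aux_II_bound n b c hbc.1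
          have := aux_II_div j n b c hbc.1 ((aux_label_le (by omega)).1 hbc.2.1)
            ((aux_label_le (by omega)).1 hbc.2.2)
          exact ih.trans this
      simp [GII] at hu hv
      have h1 := aux_label_mod (a := u) (by omega)
      have h2 := aux_label_mod (a := v) (by omega)
      rw [huj] at h1
      rw [hvj] at h2
      rw [← Nat.div_add_mod u (2 ^ j), ← Nat.div_add_mod v (2 ^ j), key, h1, h2]

/-- Let `k ≥ 2`, `G' ∈ {→G_k, ←G_k}`, and let `(N_t)_{t ∈ I}` be
finite directed graphs, each sharing with `G'` exactly the vertex `v_{i_t}` with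
`2 ≤ i_t ≤ 2^k − 2`, whose vertex sets pairwise intersect only inside `V(G')`.
If `χ_r(N_t) = h(i_t)` (where `h(m) = stdLabel m` is the standard path label) and
`N_t` has a minimal ranking `f_t` with `f_t(v_{i_t}) = h(i_t)`, then
`χ_r(G' ∪ ⋃_t N_t) = χ_r(→P_{2^k−1}) = k`. -/
theorem stmt_18 (k : ℕ) (hk : 2 ≤ k) (G' : DGraph) (hG : G' = GI k ∨ G' = GII k)
    {I : Type} (N : I → DGraph) (iv : I → ℕ)
    (hiv : ∀ t, 2 ≤ iv t ∧ iv t ≤ 2 ^ k - 2)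
    (hfin : ∀ t, (N t).verts.Finite)
    (hwf : ∀ t, ∀ p ∈ (N t).edges, p.1 ∈ (N t).verts ∧ p.2 ∈ (N t).verts)
    (hmeet : ∀ t, (N t).verts ∩ G'.verts = {iv t})
    (hdisj : ∀ s t, s ≠ t → (N s).verts ∩ (N t).verts ⊆ G'.verts)
    (hrank : ∀ t, rankNumber (N t) = stdLabel (iv t))
    (hf : ∀ t, ∃ f : ℕ → ℕ, IsRanking (N t) (rankNumber (N t)) f ∧
      f (iv t) = stdLabel (iv t)) :
    rankNumber (DGraph.mk (G'.verts ∪ ⋃ t, (N t).verts)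
        (G'.edges ∪ ⋃ t, (N t).edges)) = k ∧
    rankNumber (pathP (2 ^ k - 1)) = k := by
  classical
  obtain ⟨hV, hE, hP, hB⟩ := aux_base k hk G' hG
  choose g hg hgi using hf
  have hivN : ∀ t, iv t ∈ (N t).verts ∧ iv t ∈ G'.verts := by
    intro t
    have : iv t ∈ (N t).verts ∩ G'.verts := by rw [hmeet t]; rfl
    exact this
  have hone : ∀ t x, x ∈ (N t).verts → x ∈ G'.verts → x = iv t := by
    intro t x h1 h2
    have : x ∈ (N t).verts ∩ G'.verts := ⟨h1, h2⟩
    rw [hmeet t] at this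
    exact this
  have hsame : ∀ s t x, x ∈ (N s).verts → x ∈ (N t).verts → x ∉ G'.verts → s = t := by
    intro s t x h1 h2 h3
    by_contra hne
    exact h3 (hdisj s t hne ⟨h1, h2⟩)
  obtain ⟨F, hFG, hFN⟩ : ∃ F : ℕ → ℕ, (∀ x ∈ G'.verts, F x = stdLabel x) ∧
      ∀ t, ∀ x ∈ (N t).verts, F x = g t x := by
    refine ⟨fun x => if x ∈ G'.verts then stdLabel x else
      if h : ∃ t, x ∈ (N t).verts then g h.choose x else 0, ?_, ?_⟩
    · intro x hx
      simp [hx]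
    · intro t x hx
      by_cases hxG : x ∈ G'.verts
      · have := hone t x hx hxG
        subst this
        simp [hxG, hgi]
      · have h : ∃ t, x ∈ (N t).verts := ⟨t, hx⟩
        have := hsame _ t x h.choose_spec hx hxG
        simp only [hxG, if_false, dif_pos h]
        rw [this]
  have hFle : ∀ t, ∀ x ∈ (N t).verts, 1 ≤ F x ∧ F x ≤ F (iv t) := by
    intro t x hx
    rw [hFN t x hx, hFG _ (hivN t).2, ← hrank t]
    exact (hg t).1 x hx
  have hFk : ∀ x ∈ G'.verts, 1 ≤ F x ∧ F x ≤ k := by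
    intro x hx
    rw [hFG x hx]
    rw [hV] at hx
    have hx' : 1 ≤ x ∧ x ≤ 2 ^ k - 1 := hx
    refine ⟨by simp [stdLabel], (aux_label_le (by omega)).2 fun hd => ?_⟩
    have := Nat.le_of_dvd (by omega) hd
    omega
  have hNr : ∀ t j u v, u ∈ (N t).verts → v ∈ (N t).verts → F u = j → F v = j →
      Relation.ReflTransGen (fun a b => (a, b) ∈ (N t).edges ∧ F a ≤ j ∧ F b ≤ j) u v → u = v :=
    fun t j u v hu hv huj hvj h =>
      aux_rtg_of_rank (N t) (hwf t) _ F (g t) (hg t) (hFN t) j u v hu hv huj hvj h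
  have hGr : ∀ j u v, u ∈ G'.verts → v ∈ G'.verts → F u = j → F v = j →
      Relation.ReflTransGen (fun a b => (a, b) ∈ G'.edges ∧ F a ≤ j ∧ F b ≤ j) u v → u = v := by
    intro j u v hu hv huj hvj h
    refine hB j u v hu hv (by rw [← hFG u hu, huj]) (by rw [← hFG v hv, hvj]) (Relation.ReflTransGen.mono ?_ u v h)
    rintro a b ⟨hab, h1, h2⟩
    rw [hFG a (hE _ hab).1] at h1
    rw [hFG b (hE _ hab).2] at h2
    exact ⟨hab, h1, h2⟩
  have hrk : IsRanking (DGraph.mk (G'.verts ∪ ⋃ t, (N t).verts)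
        (G'.edges ∪ ⋃ t, (N t).edges)) k F := by
    apply aux_rank_of_rtg
    · intro v hv
      rcases hv with hv | hv
      · exact hFk v hv
      · obtain ⟨t, ht⟩ := Set.mem_iUnion.1 hv
        exact ⟨(hFle t v ht).1, (hFle t v ht).2.trans (hFk _ (hivN t).2).2⟩
    · intro u hu v hv huv h
      obtain ⟨j, hj⟩ : ∃ j, F u = j := ⟨_, rfl⟩
      rw [hj] at h huv
      by_cases huG : u ∈ G'.verts
      · have inv : ∃ y ∈ G'.verts, F y ≤ j ∧
            Relation.ReflTransGen (fun a b => (a, b) ∈ G'.edges ∧ F a ≤ j ∧ F b ≤ j) u y ∧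
            (v = y ∨ ∃ t, y = iv t ∧ v ∈ (N t).verts ∧
              Relation.ReflTransGen (fun a b => (a, b) ∈ (N t).edges ∧ F a ≤ j ∧ F b ≤ j)
                (iv t) v) := by
          clear huv hv
          induction h with
          | refl => exact ⟨u, huG, hj.le, Relation.ReflTransGen.refl, Or.inl rfl⟩
          | tail hprev hbc ih =>
            rename_i x z
            obtain ⟨y, hy, hyj, huy, hxy⟩ := ih
            obtain ⟨he | he, hx, hz⟩ := hbc
            · have hxG : x ∈ G'.verts := (hE _ he).1
              have hxy' : x = y := by
                rcases hxy with h | ⟨t, h1, h2, _⟩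
                · exact h
                · rw [h1]; exact hone t x h2 hxG
              subst hxy'
              exact ⟨z, (hE _ he).2, hz, huy.tail ⟨he, hx, hz⟩, Or.inl rfl⟩
            · obtain ⟨s, hs⟩ := Set.mem_iUnion.1 he
              have hxs := (hwf s _ hs).1
              have hzs := (hwf s _ hs).2
              refine ⟨y, hy, hyj, huy, Or.inr ⟨s, ?_⟩⟩
              by_cases hxG : x ∈ G'.verts
              · have hxy' : x = y := by
                  rcases hxy with h | ⟨t, h1, h2, _⟩
                  · exact h
                  · rw [h1]; exact hone t x h2 hxG
                have hxi := hone s x hxs hxG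
                refine ⟨hxy' ▸ hxi, hzs, ?_⟩
                rw [← hxi]
                exact Relation.ReflTransGen.single ⟨hs, hx, hz⟩
              · rcases hxy with h | ⟨t, h1, h2, h3⟩
                · exact absurd (h ▸ hy) hxG
                · have := hsame s t x hxs h2 hxG
                  subst this
                  exact ⟨h1, hzs, h3.tail ⟨hs, hx, hz⟩⟩
        obtain ⟨y, hy, hyj, huy, hvy⟩ := inv
        have : v = y := by
          rcases hvy with h | ⟨t, h1, h2, h3⟩
          · exact h
          · have := (hFle t v h2).2
            rw [h1]
            rw [h1] at hyj
            exact (hNr t j _ v (hivN t).1 h2 (by omega) huv.symm h3).symm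
        subst this
        exact hGr j u v huG hy hj huv.symm huy
      · obtain ⟨t, ht⟩ : ∃ t, u ∈ (N t).verts := by
          rcases hu with hu | hu
          · exact absurd hu huG
          · exact Set.mem_iUnion.1 hu
        have inv : v ∈ (N t).verts ∧ v ∉ G'.verts ∧
            Relation.ReflTransGen (fun a b => (a, b) ∈ (N t).edges ∧ F a ≤ j ∧ F b ≤ j) u v := by
          clear huv hv
          induction h with
          | refl => exact ⟨ht, huG, Relation.ReflTransGen.refl⟩
          | tail hprev hbc ih =>
            rename_i x z
            obtain ⟨hxt, hxG, hux⟩ := ih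
            obtain ⟨he | he, hx, hz⟩ := hbc
            · exact absurd (hE _ he).1 hxG
            · obtain ⟨s, hs⟩ := Set.mem_iUnion.1 he
              have := hsame s t x (hwf s _ hs).1 hxt hxG
              subst this
              have hzs := (hwf s _ hs).2
              have huz := hux.tail (⟨hs, hx, hz⟩ : (x, z) ∈ (N s).edges ∧ F x ≤ j ∧ F z ≤ j)
              refine ⟨hzs, fun hzG => ?_, huz⟩
              have hzi := hone s z hzs hzG
              have := (hFle s u ht).2
              rw [← hzi] at this
              exact huG ((hNr s j u z ht hzs hj (by omega) huz) ▸ hzG)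
        exact hNr t j u v ht inv.1 hj huv.symm inv.2.2
  have hsub := aux_mono (pathP (2 ^ k - 1)) (DGraph.mk (G'.verts ∪ ⋃ t, (N t).verts)
        (G'.edges ∪ ⋃ t, (N t).edges)) (fun x hx => Or.inl (by rw [hV]; exact hx))
        (fun p hp => Or.inl (hP hp))
  constructor
  · refine le_antisymm (Nat.sInf_le ⟨F, hrk⟩) (le_csInf ⟨k, F, hrk⟩ ?_)
    rintro m ⟨f, hm⟩
    exact aux_lower k m f (hsub m f hm)
  · refine le_antisymm (Nat.sInf_le ⟨F, hsub k F hrk⟩) (le_csInf ⟨k, F, hsub k F hrk⟩ ?_)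
    rintro m ⟨f, hm⟩
    exact aux_lower k m f hm
end

section
/- For every integer k ≥ 2 and all indices 1 ≤ i, j ≤ 2^k − 1, the directed edge v_i → v_j is an edge of the direct sum graph of type I →G_k if and only if the binomial coefficient C(2^k − j + i, i) is odd (equivalently, the (i,j) entry of the adjacency matrix of →G_k equals C(2^k − j + i, i) mod 2, embedding the adjacency matrix in the Sierpiński sieve triangle of Pascal's triangle mod 2). -/
theorem land_step (a b : ℕ) :
    a &&& b = 0 ↔ ((a % 2 = 0 ∨ b % 2 = 0) ∧ (a / 2) &&& (b / 2) = 0) := by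
  have h1 : (a &&& b) / 2 = (a / 2) &&& (b / 2) := Nat.and_div_two
  have h2 : (a &&& b) % 2 = 1 ↔ a % 2 = 1 ∧ b % 2 = 1 := by
    have := Nat.testBit_and a b 0
    simp only [Nat.testBit_zero] at this
    simpa using this
  rw [← h1]
  omega

theorem choose_land : ∀ a b : ℕ, Nat.choose (a + b) b % 2 = 1 ↔ a &&& b = 0 := by
  intro a
  induction a using Nat.strong_induction_on with
  | _ a ih =>
    intro b
    rcases Nat.eq_zero_or_pos a with rfl | ha
    · simp
    rw [land_step]
    have : Fact (Nat.Prime 2) := ⟨Nat.prime_two⟩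
    have L := Choose.choose_modEq_choose_mod_mul_choose_div_nat (n := a + b) (k := b) (p := 2)
    unfold Nat.ModEq at L
    rw [L]
    have IH := ih (a / 2) (by omega) (b / 2)
    rcases Nat.mod_two_eq_zero_or_one a with h | h <;>
    rcases Nat.mod_two_eq_zero_or_one b with h' | h'
    · have e : (a + b) / 2 = a / 2 + b / 2 := by omega
      have e2 : (a + b) % 2 = 0 := by omega
      rw [e, e2, h', ← IH, h]; simp
    · have e : (a + b) / 2 = a / 2 + b / 2 := by omega
      have e2 : (a + b) % 2 = 1 := by omega
      rw [e, e2, h', ← IH, h]; simp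
    · have e : (a + b) / 2 = a / 2 + b / 2 := by omega
      have e2 : (a + b) % 2 = 1 := by omega
      rw [e, e2, h', ← IH, h]; simp
    · have e2 : (a + b) % 2 = 0 := by omega
      rw [e2, h', h]; simp

theorem land_pow (n a b : ℕ) (ha : a < 2 ^ n) (hb : b < 2 ^ n) :
    (2 ^ n + a) &&& b = a &&& b := by
  apply Nat.eq_of_testBit_eq
  intro t
  simp only [Nat.testBit_and]
  by_cases h : t < n
  · rw [Nat.testBit_two_pow_add_gt h]
  · have : b.testBit t = false :=
      Nat.testBit_lt_two_pow (lt_of_lt_of_le hb (Nat.pow_le_pow_right (by norm_num) (by omega)))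
    simp [this]

theorem land_pow2 (n a b : ℕ) (ha : a < 2 ^ n) (hb : b < 2 ^ n) :
    (2 ^ n + a) &&& (2 ^ n + b) ≠ 0 := by
  intro h
  have := congrArg (fun x => x.testBit n) h
  simp [Nat.testBit_and, Nat.testBit_two_pow_add_eq, Nat.testBit_lt_two_pow ha,
    Nat.testBit_lt_two_pow hb] at this

theorem edges_bd (n : ℕ) : ∀ i j, (i, j) ∈ edgesI (n + 2) → 1 ≤ i ∧ i < j ∧ j < 2 ^ (n + 2) := by
  induction n with
  | zero =>
    intro i j h
    simp [edgesI] at h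
    omega
  | succ n ih =>
    intro i j h
    have hp : 2 ^ (n + 1 + 2) = 2 * 2 ^ (n + 2) := by ring
    have h4 : 4 ≤ 2 ^ (n + 2) := by
      have := Nat.pow_le_pow_right (n := 2) (by norm_num) (show 2 ≤ n + 2 by omega)
      simpa using this
    rw [hp]
    simp only [edgesI, Set.mem_union, Set.mem_image, Set.mem_insert_iff, Set.mem_singleton_iff,
      Set.mem_setOf_eq, Prod.mk.injEq, Prod.exists] at h
    generalize 2 ^ (n + 2) = N at *
    rcases h with ((((h | ⟨a, b, h, rfl, rfl⟩) | h | h) | ⟨b, h⟩) | ⟨b, h⟩) | ⟨a, b, h, rfl, rfl⟩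
    · have := ih _ _ h; omega
    · have := ih _ _ h; omega
    · omega
    · omega
    · omega
    · omega
    · have := ih _ _ h; omega

theorem abs_step (N : ℕ) (E : Set (ℕ × ℕ)) (i j : ℕ) (h1 : 1 ≤ i) (h2 : i < 2 * N) (h3 : 1 ≤ j)
    (h4 : j < 2 * N) (h5 : 4 ≤ N)
    (bd : ∀ i j, (i, j) ∈ E → 1 ≤ i ∧ i < j ∧ j < N)
    (A : ∀ a b, a < N → b < N → (N + a) &&& b = a &&& b)
    (B : ∀ a b, a < N → b < N → (N + a) &&& (N + b) ≠ 0)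
    (ih : ∀ i j, 1 ≤ i → i < N → 1 ≤ j → j < N → ((i, j) ∈ E ↔ (N - j) &&& i = 0)) :
    ((((((i, j) ∈ E ∨ ∃ a b, (a, b) ∈ E ∧ a + N = i ∧ b + N = j) ∨
      (i = N - 1 ∧ j = N ∨ i = N ∧ j = N + 1)) ∨
      ∃ b, 1 ≤ b ∧ b ≤ N - 2 ∧ i = b ∧ j = N) ∨
      ∃ b, 2 ≤ b ∧ b ≤ N - 1 ∧ i = N ∧ j = N + b) ∨
      ∃ a b, (a, b) ∈ E ∧ a = i ∧ b + N = j) ↔ (2 * N - j) &&& i = 0 := by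
  have C : ∀ i j, (i = 0 ∨ j = 0 ∨ N ≤ i ∨ N ≤ j ∨ j ≤ i) → (i, j) ∉ E := by
    intro i j h h'
    have := bd _ _ h'
    omega
  have i1 : (∃ a b, (a, b) ∈ E ∧ a + N = i ∧ b + N = j) ↔ (N ≤ i ∧ N ≤ j ∧ (i - N, j - N) ∈ E) := by
    constructor
    · rintro ⟨a, b, h, rfl, rfl⟩
      simpa using h
    · rintro ⟨h, h', h''⟩
      exact ⟨_, _, h'', by omega, by omega⟩
  have i2 : (∃ a b, (a, b) ∈ E ∧ a = i ∧ b + N = j) ↔ (N ≤ j ∧ (i, j - N) ∈ E) := by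
    constructor
    · rintro ⟨a, b, h, rfl, rfl⟩
      simpa using h
    · rintro ⟨h', h''⟩
      exact ⟨_, _, h'', by omega, by omega⟩
  have i3 : (∃ b, 1 ≤ b ∧ b ≤ N - 2 ∧ i = b ∧ j = N) ↔ (i ≤ N - 2 ∧ j = N) := by
    constructor
    · rintro ⟨b, h⟩; omega
    · rintro ⟨h, h'⟩; exact ⟨i, by omega⟩
  have i4 : (∃ b, 2 ≤ b ∧ b ≤ N - 1 ∧ i = N ∧ j = N + b) ↔ (i = N ∧ N + 2 ≤ j) := by
    constructor
    · rintro ⟨b, h⟩; omega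
    · rintro ⟨h, h'⟩; exact ⟨j - N, by omega⟩
  rw [i1, i2, i3, i4]
  rcases lt_trichotomy i N with hi | hi | hi <;> rcases lt_trichotomy j N with hj | hj | hj
  · have e : 2 * N - j = N + (N - j) := by omega
    rw [e, A _ _ (by omega) hi, ← ih i j h1 hi h3 hj]
    constructor
    · rintro (((((h | h) | h | h) | h) | h) | h)
      · exact h
      all_goals omega
    · intro h; exact Or.inl (Or.inl (Or.inl (Or.inl (Or.inl h))))
  · subst hj
    have e : 2 * j - j = j + 0 := by omega
    rw [e, A _ _ (by omega) hi]
    simp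
    omega
  · have e : 2 * N - j = N - (j - N) := by omega
    rw [e, ← ih i (j - N) h1 hi (by omega) (by omega)]
    have := C i j (by omega)
    constructor
    · rintro (((((h | h) | h | h) | h) | h) | h)
      · exact absurd h this
      all_goals first | omega | exact h.2
    · intro h; exact Or.inr ⟨hj.le, h⟩
  · subst hi
    have e : 2 * i - j = i + (i - j) := by omega
    have := B (i - j) 0 (by omega) (by omega)
    rw [e]
    have c1 := C i j (by omega)
    simp only [add_zero] at this
    have c2 : ¬ i ≤ j := by omega
    simp only [this, c1, c2, false_and, and_false, false_or, or_false, iff_false]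
    omega
  · subst hj
    subst hi
    have e : 2 * i - i = i := by omega
    rw [e]
    have c1 := C i i (by omega)
    have c2 := C (i - i) (i - i) (by omega)
    have c3 := C (i) (i - i) (by omega)
    simp only [Nat.and_self, c1, c2, c3, false_and, and_false, false_or, or_false, iff_false]
    omega
  · subst hi
    have e := A 0 (2 * i - j) (by omega) (by omega)
    simp only [add_zero, Nat.zero_and] at e
    rw [Nat.land_comm, e]
    simp
    omega
  · have e : 2 * N - j = N + (N - j) := by omega
    have := B (N - j) (i - N) (by omega) (by omega)
    rw [← e, Nat.add_sub_cancel' hi.le] at this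
    have c1 := C i j (by omega)
    have c2 : ¬ N ≤ j := by omega
    simp only [this, c1, c2, false_and, and_false, false_or, or_false, iff_false]
    omega
  · subst hj
    have := B 0 (i - j) (by omega) (by omega)
    rw [Nat.add_sub_cancel' hi.le, add_zero] at this
    have e : 2 * j - j = j := by omega
    rw [e]
    have c1 := C i j (by omega)
    have c2 := C (i - j) (j - j) (by omega)
    have c3 := C i (j - j) (by omega)
    simp only [this, c1, c2, c3, false_and, and_false, false_or, or_false, iff_false]
    omega
  · have e : 2 * N - j = N - (j - N) := by omega
    have := A (i - N) (N - (j - N)) (by omega) (by omega)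
    rw [Nat.add_sub_cancel' hi.le] at this
    rw [e, Nat.land_comm, this, Nat.land_comm, ← ih (i - N) (j - N) (by omega) (by omega) (by omega) (by omega)]
    have c1 := C i j (by omega)
    have c3 := C i (j - N) (by omega)
    constructor
    · rintro (((((h | h) | h | h) | h) | h) | h)
      · exact absurd h c1
      · exact h.2.2
      · omega
      · omega
      · omega
      · omega
      · exact absurd h.2 c3
    · intro h
      have : N ≤ i ∧ N ≤ j ∧ (i - N, j - N) ∈ E := ⟨hi.le, hj.le, h⟩
      exact Or.inl (Or.inl (Or.inl (Or.inl (Or.inr this))))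

theorem edges_land (n : ℕ) : ∀ i j, 1 ≤ i → i < 2 ^ (n + 2) → 1 ≤ j → j < 2 ^ (n + 2) →
    ((i, j) ∈ edgesI (n + 2) ↔ (2 ^ (n + 2) - j) &&& i = 0) := by
  induction n with
  | zero =>
    intro i j h1 h2 h3 h4
    simp only [Nat.zero_add, Nat.reducePow] at h2 h4
    interval_cases i <;> interval_cases j <;> simp [edgesI]
  | succ n ih =>
    intro i j h1 h2 h3 h4
    have bd := edges_bd n
    have hp : 2 ^ (n + 1 + 2) = 2 * 2 ^ (n + 2) := by ring
    have h5 : 4 ≤ 2 ^ (n + 2) := by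
      have := Nat.pow_le_pow_right (n := 2) (by norm_num) (show 2 ≤ n + 2 by omega)
      simpa using this
    have A := land_pow (n + 2)
    have B := land_pow2 (n + 2)
    rw [hp] at h2 h4 ⊢
    simp only [edgesI, Set.mem_union, Set.mem_image, Set.mem_insert_iff, Set.mem_singleton_iff,
      Set.mem_setOf_eq, Prod.mk.injEq, Prod.exists]
    exact abs_step _ _ i j h1 h2 h3 h4 h5 bd A B ih

/-- For `k ≥ 2` and `1 ≤ i, j ≤ 2^k − 1`, the edge `v_i → v_j` belongs
to `→G_k` iff the binomial coefficient `C(2^k − j + i, i)` is odd, i.e., the `(i,j)`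
entry of the adjacency matrix of `→G_k` is `C(2^k − j + i, i) mod 2`, embedding the
adjacency matrix in the Sierpiński sieve (Pascal's triangle mod 2). -/
theorem stmt_19 (k i j : ℕ) (hk : 2 ≤ k) (hi1 : 1 ≤ i) (hi2 : i ≤ 2 ^ k - 1)
    (hj1 : 1 ≤ j) (hj2 : j ≤ 2 ^ k - 1) :
    (i, j) ∈ edgesI k ↔ Nat.choose (2 ^ k - j + i) i % 2 = 1 := by
  obtain ⟨n, rfl⟩ : ∃ n, k = n + 2 := ⟨k - 2, by omega⟩
  have hp : 0 < 2 ^ (n + 2) := by positivity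
  rw [choose_land, edges_land n i j hi1 (by omega) hj1 (by omega)]
end
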